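/- Let Jac be the solution space of a Jacobi equation J'' + R(t)J = 0 on a finite-dimensional real inner product space E with each R(t) symmetric, and let W ⊆ Jac be an isotropic subspace for the canonical symplectic form. Then the set of W-focal points, i.e. the set of t ∈ ℝ with dim W(t) < dim W where W(t) = {J(t) : J ∈ W}, is a discrete subset of ℝ. -/

import Mathlib

open Module RealInnerProductSpace

noncomputable section

/-- `J` is a (normal) Jacobi field for the family of operators `R`, i.e. a `C²`
solution of the Jacobi equation `J'' + R(t) J = 0`. -/
def IsJacobiField {E : Type*} [NormedAddCommGroup E] [NormedSpace ℝ E]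
    (R : ℝ → E →ₗ[ℝ] E) (J : ℝ → E) : Prop :=
  ContDiff ℝ 2 J ∧ ∀ t : ℝ, deriv (deriv J) t = - R t (J t)

/-- `W(t)`: the image of an evaluation map on a space of functions at time `t`. -/
def evalAt {E : Type*} [NormedAddCommGroup E] [NormedSpace ℝ E] (t : ℝ)
    (W : Submodule ℝ (ℝ → E)) : Submodule ℝ E :=
  W.map (LinearMap.proj t : (ℝ → E) →ₗ[ℝ] E)

open Filter Topology in
theorem jacobi_unique {E : Type*} [NormedAddCommGroup E]
    [InnerProductSpace ℝ E] [FiniteDimensional ℝ E] (R : ℝ → E →ₗ[ℝ] E)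
    (hRcont : Continuous fun p : ℝ × E => R p.1 p.2) (J : ℝ → E) (hJ : IsJacobiField R J)
    (t₀ : ℝ) (h0 : J t₀ = 0) (h1 : deriv J t₀ = 0) : J = 0 := by
  obtain ⟨hc, hode⟩ := hJ
  have hd : Differentiable ℝ J := hc.differentiable (by norm_num)
  have hd2 : Differentiable ℝ (deriv J) := by
    have : ContDiff ℝ (1 + 1) J := by simpa [one_add_one_eq_two] using hc
    exact (contDiff_succ_iff_deriv.1 this).2.2.differentiable (by norm_num)
  let v : ℝ → (E × E) →L[ℝ] (E × E) := fun t =>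
    (ContinuousLinearMap.snd ℝ E E).prod
      (-((LinearMap.toContinuousLinearMap (R t)).comp (ContinuousLinearMap.fst ℝ E E)))
  have hv : Continuous v := by
    rw [continuous_clm_apply]
    intro y
    have h : Continuous fun t : ℝ => R t y.1 :=
      hRcont.comp (continuous_id.prodMk continuous_const)
    exact continuous_const.prodMk h.neg
  funext t
  let r := |t - t₀| + 1
  obtain ⟨K, hK⟩ := (isCompact_Icc (a := t₀ - r) (b := t₀ + r)).exists_bound_of_continuousOn
    (f := v) hv.continuousOn
  have key := ODE_solution_unique_of_mem_Ioo (K := K.toNNReal) (v := fun t x => v t x)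
    (s := fun _ => Set.univ) (a := t₀ - r) (b := t₀ + r) (t₀ := t₀)
    (f := fun t => (J t, deriv J t)) (g := fun _ => 0) ?_ ?_ ?_ ?_ ?_
  · have ht : t ∈ Set.Ioo (t₀ - r) (t₀ + r) := by
      have := abs_lt.1 (show |t - t₀| < r by simp [r])
      constructor <;> linarith [this.1, this.2]
    exact congrArg Prod.fst (key ht)
  · intro s hs
    refine ((v s).lipschitz.weaken ?_).lipschitzOnWith
    rw [← NNReal.coe_le_coe]
    exact (hK s ⟨hs.1.le, hs.2.le⟩).trans (Real.le_coe_toNNReal K)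
  · have : 0 < r := by positivity
    constructor <;> linarith
  · intro s _
    refine ⟨?_, trivial⟩
    have h2 : HasDerivAt (deriv J) (-(R s (J s))) s := by
      rw [← hode]; exact (hd2 s).hasDerivAt
    exact (hd s).hasDerivAt.prodMk h2
  · intro s _
    refine ⟨?_, trivial⟩
    rw [map_zero]
    exact hasDerivAt_const s 0
  · simp [h0, h1]

open Filter Topology in
/-- For an isotropic subspace `W` of Jacobi fields, the set of `W`-focal points, i.e. the
set of `t` with `dim W(t) < dim W`, is discrete in `ℝ`. -/
theorem focal_points_discrete {E : Type*} [NormedAddCommGroup E]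
    [InnerProductSpace ℝ E] [FiniteDimensional ℝ E] (R : ℝ → E →ₗ[ℝ] E)
    (hRcont : Continuous fun p : ℝ × E => R p.1 p.2)
    (hRsym : ∀ t : ℝ, (R t).IsSymmetric)
    (W : Submodule ℝ (ℝ → E)) (hsol : ∀ J ∈ W, IsJacobiField R J)
    (hiso : ∀ J₁ ∈ W, ∀ J₂ ∈ W, ∀ t : ℝ,
      (⟪deriv J₁ t, J₂ t⟫ : ℝ) - ⟪J₁ t, deriv J₂ t⟫ = 0) :
    ∀ t₀ ∈ {t : ℝ | finrank ℝ (evalAt t W) < finrank ℝ W},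
      ∃ ε > (0 : ℝ), ∀ t ∈ {t : ℝ | finrank ℝ (evalAt t W) < finrank ℝ W},
        |t - t₀| < ε → t = t₀ := by
  intro t₀ _
  have hdiff : ∀ J : W, ∀ t, DifferentiableAt ℝ (J : ℝ → E) t := fun J t =>
    (hsol J J.2).1.differentiable (by norm_num) t
  let ev : ℝ → W →ₗ[ℝ] E := fun t => (LinearMap.proj t : (ℝ → E) →ₗ[ℝ] E).comp W.subtype
  have hev : ∀ t (J : W), ev t J = (J : ℝ → E) t := fun _ _ => rfl
  let D : W →ₗ[ℝ] E :=
    { toFun := fun J => deriv (J : ℝ → E) t₀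
      map_add' := fun J K => deriv_add (hdiff J t₀) (hdiff K t₀)
      map_smul' := fun c J => deriv_const_smul c (hdiff J t₀) }
  have hD : ∀ J : W, D J = deriv (J : ℝ → E) t₀ := fun _ => rfl
  have huniq : ∀ J : W, ev t₀ J = 0 → D J = 0 → J = 0 := fun J h0 h1 =>
    Subtype.ext (jacobi_unique R hRcont J (hsol J J.2) t₀ h0 h1)
  have hfin : FiniteDimensional ℝ W := by
    refine FiniteDimensional.of_injective ((ev t₀).prod D) ?_
    rw [← LinearMap.ker_eq_bot, LinearMap.ker_eq_bot']
    intro J hJ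
    exact huniq J (congrArg Prod.fst hJ) (congrArg Prod.snd hJ)
  have hfocal : ∀ t, Function.Injective (ev t) →
      ¬ finrank ℝ (evalAt t W) < finrank ℝ W := by
    intro t hi
    have h1 : evalAt t W = LinearMap.range (ev t) := by
      simp [evalAt, ev, LinearMap.range_comp]
    rw [h1, LinearMap.finrank_range_of_inj hi]
    exact lt_irrefl _
  obtain ⟨C, hC⟩ := Submodule.exists_isCompl (LinearMap.ker (ev t₀))
  let P : W →ₗ[ℝ] W := (LinearMap.ker (ev t₀)).projection C hC
  have hP0 : ∀ J, ev t₀ (P J) = 0 := fun J =>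
    LinearMap.mem_ker.1 (Submodule.projection_apply_mem hC J)
  have hPC : ∀ J, J - P J ∈ C := fun J => Submodule.sub_projection_mem hC J
  have hPid : ∀ J, ev t₀ J = 0 → P J = J := fun J hJ =>
    Submodule.projection_apply_left hC ⟨J, hJ⟩
  let L : ℝ → W →ₗ[ℝ] E := fun t => (t - t₀)⁻¹ • (ev t).comp P + (ev t).comp (LinearMap.id - P)
  let L0 : W →ₗ[ℝ] E := D.comp P + (ev t₀).comp (LinearMap.id - P)
  have hL0 : LinearMap.ker L0 = ⊥ := by
    rw [LinearMap.ker_eq_bot']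
    intro J hJ
    have hJ' : D (P J) + ev t₀ (J - P J) = 0 := hJ
    have horth : (⟪D (P J), ev t₀ (J - P J)⟫ : ℝ) = 0 := by
      have := hiso (P J) (P J).2 (J - P J : W) (J - P J).2 t₀
      rw [← hev t₀ (P J), hP0 J, inner_zero_left, sub_zero] at this
      exact this
    have hz : D (P J) = 0 := by
      have h2 : ev t₀ (J - P J) = - D (P J) := by
        rw [eq_neg_iff_add_eq_zero, add_comm]; exact hJ'
      rw [h2, inner_neg_right, neg_eq_zero] at horth
      exact inner_self_eq_zero.1 horth
    have hPJ : P J = 0 := huniq _ (hP0 J) hz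
    rw [hz, hPJ, zero_add, sub_zero] at hJ'
    rw [← hPid J hJ', hPJ]
  have hlim : ∀ J : W, Tendsto (fun t => L t J) (𝓝[≠] t₀) (𝓝 (L0 J)) := by
    intro J
    have h1 : Tendsto (fun t => (t - t₀)⁻¹ • ev t (P J)) (𝓝[≠] t₀) (𝓝 (D (P J))) := by
      have := hasDerivAt_iff_tendsto_slope.1 (hdiff (P J) t₀).hasDerivAt
      refine this.congr fun t => ?_
      rw [slope_def_module, ← hev t₀ (P J), hP0, sub_zero, hev]
    have h2 : Tendsto (fun t => ev t (J - P J)) (𝓝[≠] t₀) (𝓝 (ev t₀ (J - P J))) :=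
      (hdiff (J - P J) t₀).continuousAt.tendsto.mono_left nhdsWithin_le_nhds
    exact h1.add h2
  let b := Module.finBasis ℝ W
  have hli : LinearIndependent ℝ (fun i => L0 (b i)) :=
    b.linearIndependent.map' L0 hL0
  have hT : Tendsto (fun t => fun i => L t (b i)) (𝓝[≠] t₀) (𝓝 (fun i => L0 (b i))) :=
    tendsto_pi_nhds.2 fun i => hlim (b i)
  have hE := hT.eventually hli.eventually
  rw [eventually_nhdsWithin_iff, Metric.eventually_nhds_iff] at hE
  obtain ⟨ε, hε, H⟩ := hE
  refine ⟨ε, hε, fun t ht hlt => ?_⟩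
  by_contra hne
  refine hfocal t ?_ ht
  have hind := H (by rwa [Real.dist_eq]) hne
  have hker : ∀ J, L t J = 0 → J = 0 := by
    intro J hJ
    rw [← b.sum_repr J, map_sum] at hJ
    simp only [map_smul] at hJ
    have := Fintype.linearIndependent_iff.1 hind _ hJ
    rw [← b.sum_repr J]
    simp [this]
  have hs : t - t₀ ≠ 0 := sub_ne_zero.2 hne
  rw [← LinearMap.ker_eq_bot, LinearMap.ker_eq_bot']
  intro J hJ
  have hPP : P (P J) = P J := hPid _ (hP0 J)
  have hx := hker ((t - t₀) • P J + (J - P J)) (by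
    change (t - t₀)⁻¹ • ev t (P ((t - t₀) • P J + (J - P J))) +
      ev t (((t - t₀) • P J + (J - P J)) - P ((t - t₀) • P J + (J - P J))) = 0
    have : P ((t - t₀) • P J + (J - P J)) = (t - t₀) • P J := by
      simp [hPP]
    rw [this, add_sub_cancel_left, map_smul, inv_smul_smul₀ hs, ← map_add,
      add_sub_cancel, hJ])
  have hPJ : P J = 0 := by
    have h3 := congrArg P hx
    rw [map_add, map_smul, map_sub, hPP, sub_self, add_zero, map_zero] at h3
    exact (smul_eq_zero.1 h3).resolve_left hs
  simpa [hPJ] using hx
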